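/- Let k ≥ 3 be an odd integer, ω = exp(2πi/k), and let H be the Hermitian adjacency matrix of a connected mixed graph on a finite nonempty vertex set V, with Δ the maximum degree of the underlying graph. If −Δ is an eigenvalue of H, then the underlying graph of H is Δ-regular, and there exist f : V → ZMod k and s : V → Bool such that for all u, v: if H u v = 1 then f u = f v and s u ≠ s v, and if H u v = ω then f u − f v = 1 in ZMod k and s u ≠ s v. (In particular the underlying graph is bipartite, with bipartition classes given by s.) -/

import Mathlib

/-- The extremal case of the triangle inequality: if `∑ z i = -(D • a)` with at least as large a
`D` as there are summands, none of norm larger than `a`, then every summand is `-a`. -/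
lemma eq_neg_of_sum_eq_neg_smul {ι : Type*} (S : Finset ι) (z : ι → ℂ) (a : ℂ) (D : ℕ)
    (hD : S.card ≤ D) (ha : a ≠ 0) (hz : ∀ i ∈ S, ‖z i‖ ≤ ‖a‖)
    (hsum : ∑ i ∈ S, z i = -(D : ℂ) * a) :
    S.card = D ∧ ∀ i ∈ S, z i = -a := by
  have hD' : (S.card : ℝ) ≤ D := by exact_mod_cast hD
  have hpos : 0 < ‖a‖ ^ 2 := by positivity
  have hnonneg : ∀ i ∈ S, 0 ≤ ‖a‖ ^ 2 + inner ℝ a (z i) := fun i hi => by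
    have h := (abs_le.mp (abs_real_inner_le_norm a (z i))).1
    nlinarith [hz i hi, norm_nonneg a]
  have htotal : ∑ i ∈ S, (‖a‖ ^ 2 + inner ℝ a (z i)) = (S.card - D : ℝ) * ‖a‖ ^ 2 := by
    have h : -(D : ℂ) * a = (-(D : ℝ)) • a := by simp
    rw [Finset.sum_add_distrib, ← inner_sum, hsum, h, real_inner_smul_right,
      real_inner_self_eq_norm_sq, Finset.sum_const, nsmul_eq_mul]
    ring
  have hge : 0 ≤ (S.card - D : ℝ) * ‖a‖ ^ 2 := htotal ▸ Finset.sum_nonneg hnonneg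
  have hcard : (S.card : ℝ) = D := by nlinarith
  refine ⟨by exact_mod_cast hcard, fun i hi => ?_⟩
  rw [hcard, sub_self, zero_mul, Finset.sum_eq_zero_iff_of_nonneg hnonneg] at htotal
  have hi0 := htotal i hi
  have hsq : ‖z i + a‖ ^ 2 ≤ 0 := by
    rw [norm_add_sq_real, real_inner_comm]
    nlinarith [hz i hi, norm_nonneg (z i)]
  have h0 : ‖z i + a‖ = 0 := by nlinarith [norm_nonneg (z i + a)]
  exact eq_neg_of_add_eq_zero_left (norm_eq_zero.mp h0)

/-- A property that passes to neighbors holds everywhere in a connected graph once it holds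
somewhere. -/
lemma SimpleGraph.Connected.forall_of_adj {V : Type*} {G : SimpleGraph V} (hG : G.Connected)
    {p : V → Prop} {w : V} (hw : p w) (hp : ∀ u v, G.Adj u v → p u → p v) (v : V) : p v := by
  obtain ⟨W⟩ := hG.preconnected w v
  induction W with
  | nil => exact hw
  | cons h _ ih => exact ih (hp _ _ h hw)

/-- The sign `-1` or `1` attached to a Boolean. -/
def boolSign (b : Bool) : ℂ := if b then -1 else 1

lemma boolSign_not (b : Bool) : boolSign (!b) = -boolSign b := by
  cases b <;> simp [boolSign]

lemma boolSign_ne_zero (b : Bool) : boolSign b ≠ 0 := by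
  cases b <;> simp [boolSign]

lemma boolSign_pow_of_odd (b : Bool) {k : ℕ} (hk : Odd k) : boolSign b ^ k = boolSign b := by
  cases b <;> simp [boolSign, hk.neg_one_pow]

/-- For odd `k`, a sign times a `k`-th root of unity determines both factors. -/
lemma sign_ne_and_exponent_eq {k : ℕ} (hkodd : Odd k) {ω : ℂ} (hω : IsPrimitiveRoot ω k)
    {s t : Bool} {m n : ℤ} (h : boolSign s * ω ^ m = -(boolSign t * ω ^ n)) :
    s ≠ t ∧ (m : ZMod k) = n := by
  have hω0 : ω ≠ 0 := hω.ne_zero hkodd.pos.ne'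
  have hpow : ∀ j : ℤ, (ω ^ j) ^ k = 1 := fun j => by
    rw [← zpow_natCast, ← zpow_mul, mul_comm, zpow_mul, zpow_natCast, hω.pow_eq_one, one_zpow]
  have hsign : boolSign s = -boolSign t := by
    have := congrArg (· ^ k) h
    simpa only [hkodd.neg_pow, mul_pow, hpow, mul_one, boolSign_pow_of_odd _ hkodd] using this
  refine ⟨?_, ?_⟩
  · rintro rfl
    exact boolSign_ne_zero s (self_eq_neg.mp hsign)
  · rw [hsign, neg_mul, neg_inj] at h
    have hmn : ω ^ m = ω ^ n := mul_left_cancel₀ (boolSign_ne_zero t) h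
    rw [← sub_eq_zero, ← Int.cast_sub, ZMod.intCast_zmod_eq_zero_iff_dvd,
      ← hω.zpow_eq_one_iff_dvd, zpow_sub₀ hω0, hmn, div_self (zpow_ne_zero _ hω0)]

/-- Let `k ≥ 3` be odd. If `-Δ` is an eigenvalue of the Hermitian adjacency matrix of a
connected mixed graph `H`, then the underlying graph is `Δ`-regular and there exist
`f : V → ZMod k` and a sign function `s : V → Bool` such that every undirected edge stays within
a class of `f` and joins the two sides of `s`, and every arc goes from class `t+1` to class `t`
of `f` and joins the two sides of `s` (in particular, the underlying graph is bipartite). -/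
theorem stmt_12 {V : Type*} [Fintype V] [DecidableEq V] [Nonempty V]
    (k : ℕ) (hk : 3 ≤ k) (hkodd : Odd k) (ω : ℂ)
    (hω : ω = Complex.exp (2 * (Real.pi : ℂ) * Complex.I / (k : ℂ)))
    (H : Matrix V V ℂ) (hherm : H.IsHermitian) (hdiag : ∀ v, H v v = 0)
    (hent : ∀ u v, H u v ∈ ({0, 1, ω, (starRingEnd ℂ) ω} : Set ℂ))
    (G : SimpleGraph V) [DecidableRel G.Adj]
    (hadj : ∀ u v, G.Adj u v ↔ u ≠ v ∧ H u v ≠ 0)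
    (hconn : G.Connected)
    (heig : ∃ x : V → ℂ, x ≠ 0 ∧ H.mulVec x = (-(G.maxDegree : ℂ)) • x) :
    G.IsRegularOfDegree G.maxDegree ∧
      ∃ (f : V → ZMod k) (s : V → Bool), ∀ u v,
        (H u v = 1 → f u = f v ∧ s u ≠ s v) ∧
        (H u v = ω → f u - f v = 1 ∧ s u ≠ s v) := by
  have hk0 : k ≠ 0 := by omega
  have hprim : IsPrimitiveRoot ω k := hω ▸ Complex.isPrimitiveRoot_exp k hk0
  have hω0 : ω ≠ 0 := hprim.ne_zero hk0
  have hnorm : ‖ω‖ = 1 := hprim.norm'_eq_one hk0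
  have hconj : (starRingEnd ℂ) ω = ω ^ (-1 : ℤ) := by
    rw [zpow_neg_one, Complex.inv_eq_conj hnorm]
  have hexp : ∀ u v, G.Adj u v → ∃ e : ℤ, H u v = ω ^ e := fun u v huv => by
    rcases hent u v with h | h | h | h
    · exact absurd h ((hadj u v).mp huv).2
    · exact ⟨0, by simpa using h⟩
    · exact ⟨1, by simpa using h⟩
    · exact ⟨-1, h.trans hconj⟩
  obtain ⟨x, hx0, hx⟩ := heig
  obtain ⟨w, hw⟩ := Finite.exists_max fun v => ‖x v‖
  have hxw : x w ≠ 0 := fun h => hx0 <| funext fun v => by simpa [h] using hw v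
  have hnormH : ∀ u v, G.Adj u v → ‖H u v * x v‖ = ‖x v‖ := fun u v huv => by
    obtain ⟨e, he⟩ := hexp u v huv
    rw [he, norm_mul, norm_zpow, hnorm, one_zpow, one_mul]
  have hsum : ∀ v, ∑ u ∈ G.neighborFinset v, H v u * x u = -(G.maxDegree : ℂ) * x v := fun v => by
    have h := congrFun hx v
    simp only [Matrix.mulVec, dotProduct, Pi.smul_apply, smul_eq_mul] at h
    rw [← h]
    refine Finset.sum_subset (Finset.subset_univ _) fun u _ hu => ?_
    rw [SimpleGraph.mem_neighborFinset, hadj, not_and, not_not] at hu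
    rcases eq_or_ne v u with rfl | hvu
    · rw [hdiag, zero_mul]
    · rw [hu hvu, zero_mul]
  have hlocal : ∀ v, ‖x v‖ = ‖x w‖ →
      G.degree v = G.maxDegree ∧ ∀ u, G.Adj v u → H v u * x u = -x v := fun v hv => by
    have := eq_neg_of_sum_eq_neg_smul (G.neighborFinset v) (fun u => H v u * x u) (x v) G.maxDegree
      (G.degree_le_maxDegree v) (norm_ne_zero_iff.mp (hv ▸ norm_ne_zero_iff.mpr hxw))
      (fun u hu => by
        rw [hnormH v u ((G.mem_neighborFinset v u).mp hu), hv]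
        exact hw u) (hsum v)
    exact ⟨this.1, fun u hu => this.2 u ((G.mem_neighborFinset v u).mpr hu)⟩
  have hmax : ∀ v, ‖x v‖ = ‖x w‖ :=
    hconn.forall_of_adj (p := fun v => ‖x v‖ = ‖x w‖) rfl fun u v huv hu => by
      rw [← hnormH u v huv, (hlocal u hu).2 v huv, norm_neg, hu]
  refine ⟨fun v => (hlocal v (hmax v)).1, ?_⟩
  have hedge : ∀ u v, G.Adj u v → H u v * x v = -x u := fun u => (hlocal u (hmax u)).2
  have hphase : ∀ v, ∃ (s : Bool) (n : ℤ), x v = boolSign s * ω ^ n * x w := by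
    refine hconn.forall_of_adj (w := w) ⟨false, 0, by simp [boolSign]⟩ ?_
    rintro u v huv ⟨s, n, hu⟩
    obtain ⟨e, he⟩ := hexp u v huv
    have h := hedge u v huv
    refine ⟨!s, n - e, mul_left_cancel₀ (zpow_ne_zero e hω0) ?_⟩
    rw [← he, h, he, hu, boolSign_not, zpow_sub₀ hω0]
    field_simp
  choose s n hsn using hphase
  have hcompare : ∀ (u v : V) (e : ℤ), H u v = ω ^ e →
      s u ≠ s v ∧ ((n u : ℤ) : ZMod k) = ((e + n v : ℤ) : ZMod k) := fun u v e he => by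
    have hne : H u v ≠ 0 := he ▸ zpow_ne_zero e hω0
    have huv : G.Adj u v := (hadj u v).mpr ⟨fun h => hne (h ▸ hdiag u), hne⟩
    have h := hedge u v huv
    rw [he, hsn u, hsn v] at h
    refine sign_ne_and_exponent_eq hkodd hprim (mul_right_cancel₀ hxw ?_)
    rw [zpow_add₀ hω0]
    linear_combination h
  refine ⟨fun v => (n v : ZMod k), s, fun u v => ⟨fun h => ?_, fun h => ?_⟩⟩
  · obtain ⟨hs, hn⟩ := hcompare u v 0 (by simpa using h)
    exact ⟨by simpa using hn, hs⟩
  · obtain ⟨hs, hn⟩ := hcompare u v 1 (by simpa using h)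
    exact ⟨by simp [hn], hs⟩
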